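/- Let A_1,…,A_m be d×d positive semidefinite hermitian matrices, let ε_i = ±1 for i = 1,…,m, and set Q_m(x, z_1,…,z_m) = ∏_{i=1}^m (1 − ε_i ∂_{z_i}) det(x·I + Σ_{i=1}^m z_i A_i). If x_0 > 0 and x_0 > maxroot(μ[ε_1 A_1,…,ε_m A_m]), then the point (x_0, 0,…,0) ∈ ℝ^{m+1} is above the roots of Q_m. -/

import Mathlib

open scoped ComplexOrder

/-- The mixed characteristic polynomial
`μ[A_1,…,A_m](x) = ∏ (1 − ∂_{z_i}) det(x I + Σ z_i A_i) |_{z=0}`. -/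
noncomputable def mixedCharPoly {m d : ℕ} (A : Fin m → Matrix (Fin d) (Fin d) ℂ) :
    Polynomial ℂ :=
  MvPolynomial.eval (fun _ => (0 : Polynomial ℂ))
    ((List.ofFn fun i : Fin m =>
        ((1 : Module.End (Polynomial ℂ) (MvPolynomial (Fin m) (Polynomial ℂ))) -
          (MvPolynomial.pderiv i).toLinearMap :
          Module.End (Polynomial ℂ) (MvPolynomial (Fin m) (Polynomial ℂ)))).prod
      (Matrix.det (Matrix.of fun a b =>
        MvPolynomial.C Polynomial.X * (if a = b then 1 else 0) +
          ∑ i, MvPolynomial.X i * MvPolynomial.C (Polynomial.C (A i a b)))))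

/-- The largest real root of a polynomial with complex coefficients. -/
noncomputable def maxRoot (p : Polynomial ℂ) : ℝ :=
  sSup {x : ℝ | p.IsRoot (x : ℂ)}

/-- A real point is above the roots of a complex-coefficient polynomial `Q` in the
variables `σ` if the values `Q(z + t)`, `t ≥ 0`, are (real and) positive. -/
def AboveRootsC {σ : Type*} (Q : MvPolynomial σ ℂ) (z : σ → ℝ) : Prop :=
  ∀ t : σ → ℝ, (∀ i, 0 ≤ t i) →
    (MvPolynomial.eval (fun i => ((z i + t i : ℝ) : ℂ)) Q).im = 0 ∧
    0 < (MvPolynomial.eval (fun i => ((z i + t i : ℝ) : ℂ)) Q).re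


open Polynomial in
theorem Polynomial.eval_sub_mul_derivative_ne_zero {u : ℂ[X]}
    (hu : ∀ w : ℂ, 0 ≤ w.im → u.eval w ≠ 0) (c : ℝ) {w : ℂ} (hw : 0 ≤ w.im) :
    u.eval w - c * u.derivative.eval w ≠ 0 := by
  intro h
  have h0 := hu w hw
  have hu0 : u ≠ 0 := by rintro rfl; simp at h0
  have hS := (IsAlgClosed.splits u).eval_derivative_div_eval_of_ne_zero h0
  have him : ∀ s : Multiset ℂ, (∀ r ∈ s, r.im < 0) →
      (s.map fun z ↦ 1 / (w - z)).sum.im ≤ 0 ∧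
        ((s.map fun z ↦ 1 / (w - z)).sum.im = 0 → s = 0) := by
    intro s
    induction s using Multiset.induction_on with
    | empty => simp
    | cons a s ih =>
      intro hs
      have ih := ih fun r hr => hs r (Multiset.mem_cons_of_mem hr)
      have ha := hs a (Multiset.mem_cons_self a s)
      have hwa : 0 < (w - a).im := by rw [Complex.sub_im]; linarith
      have hne : w - a ≠ 0 := by intro h; simp [h] at hwa
      have : (1 / (w - a)).im < 0 := by
        rw [one_div, Complex.inv_im]
        exact div_neg_of_neg_of_pos (by linarith) (Complex.normSq_pos.2 hne)
      simp only [Multiset.map_cons, Multiset.sum_cons, Complex.add_im]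
      exact ⟨by linarith [ih.1], fun h => by linarith [ih.1]⟩
  obtain ⟨-, hS0⟩ := him u.roots fun r hr => by
    by_contra! hr'
    exact hu r hr' ((mem_roots hu0).1 hr)
  rw [← hS] at hS0
  have h1 : (c : ℂ) * (u.derivative.eval w / u.eval w) = 1 := by
    field_simp
    linear_combination -h
  have hc : c ≠ 0 := by rintro rfl; simp at h1
  have h2 := congrArg Complex.im h1
  rw [Complex.im_ofReal_mul, Complex.one_im, mul_eq_zero, or_iff_right hc] at h2
  rw [hS, hS0 h2] at h1
  simp at h1

theorem MvPolynomial.derivative_aeval_update {σ R : Type*} [CommRing R] [DecidableEq σ]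
    (v : σ → R) (i : σ) (p : MvPolynomial σ R) :
    (aeval (Function.update (fun j => Polynomial.C (v j)) i Polynomial.X) p).derivative =
      aeval (Function.update (fun j => Polynomial.C (v j)) i Polynomial.X) (pderiv i p) := by
  induction p using MvPolynomial.induction_on with
  | C a => simp
  | add p q hp hq => simp [hp, hq]
  | mul_X p j hp =>
    rw [map_mul, Polynomial.derivative_mul, hp, pderiv_mul]
    by_cases hj : j = i
    · subst hj; simp
    · simp [hj]

theorem MvPolynomial.eval_aeval_update {σ R : Type*} [CommRing R] [DecidableEq σ]
    (v : σ → R) (i : σ) (p : MvPolynomial σ R) (w : R) :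
    (aeval (Function.update (fun j => Polynomial.C (v j)) i Polynomial.X) p).eval w =
      eval (Function.update v i w) p := by
  induction p using MvPolynomial.induction_on with
  | C a => simp
  | add p q hp hq => simp [hp, hq]
  | mul_X p j hp =>
    rw [map_mul, Polynomial.eval_mul, hp, map_mul]
    by_cases hj : j = i
    · subst hj; simp
    · simp [hj]

/-- Nonvanishing of `p` for `x` in the open and all `z_i` in the closed upper half-plane. -/
def UpperNonvanishing {ι : Type*} (p : MvPolynomial (Option ι) ℂ) : Prop :=
  ∀ v : Option ι → ℂ, 0 < (v none).im → (∀ i, 0 ≤ (v (some i)).im) → MvPolynomial.eval v p ≠ 0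

theorem UpperNonvanishing.sub_smul_pderiv {ι : Type*} {p : MvPolynomial (Option ι) ℂ}
    (hp : UpperNonvanishing p) (c : ℝ) (i : ι) :
    UpperNonvanishing (p - (c : ℂ) • MvPolynomial.pderiv (some i) p) := by
  classical
  intro v h0 h
  have key := Polynomial.eval_sub_mul_derivative_ne_zero
    (u := MvPolynomial.aeval (Function.update (fun j => Polynomial.C (v j)) (some i)
      Polynomial.X) p) (fun w hw => ?_) c (h i)
  · rw [MvPolynomial.derivative_aeval_update, MvPolynomial.eval_aeval_update,
      MvPolynomial.eval_aeval_update, Function.update_eq_self] at key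
    rwa [map_sub, MvPolynomial.smul_eval]
  · rw [MvPolynomial.eval_aeval_update]
    refine hp _ (by simpa using h0) fun j => ?_
    by_cases hj : j = i
    · subst hj; simpa using hw
    · simpa [Function.update_of_ne, hj] using h j

open Polynomial in
theorem Polynomial.splits_of_eval_ne_zero_of_im_pos {p : ℝ[X]}
    (h : ∀ z : ℂ, 0 < z.im → (p.map Complex.ofRealHom).eval z ≠ 0) : p.Splits := by
  refine Splits.of_splits_map Complex.ofRealHom (IsAlgClosed.splits _) fun a ha => ?_
  have ha0 : (p.map Complex.ofRealHom).eval a = 0 := (mem_roots'.1 ha).2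
  have ha1 : (p.map Complex.ofRealHom).eval (starRingEnd ℂ a) = 0 := by
    have := congrArg (starRingEnd ℂ) ha0
    rw [eval_map, hom_eval₂, map_zero] at this
    rw [eval_map, ← this]
    congr 1
    ext
    simp
  refine ⟨a.re, Complex.ext (by simp) ?_⟩
  rcases lt_trichotomy a.im 0 with him | him | him
  · exact absurd ha1 (h _ (by simpa using him))
  · simp [him]
  · exact absurd ha0 (h _ him)

open Polynomial in
theorem Polynomial.Splits.coeff_pos {p : ℝ[X]} (hp : p.Splits) (hlc : 0 < p.leadingCoeff)
    (h : ∀ x, 0 ≤ x → p.eval x ≠ 0) {k : ℕ} (hk : k ≤ p.natDegree) : 0 < p.coeff k := by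
  have key : ∀ s : Multiset ℝ, (∀ r ∈ s, r < 0) → ∀ k ≤ s.card,
      0 < (s.map fun a => X - C a).prod.coeff k := by
    intro s
    induction s using Multiset.induction_on with
    | empty => intro _ k hk; simp at hk; simp [hk]
    | cons a s ih =>
      intro hs k hk
      have ih := ih fun r hr => hs r (Multiset.mem_cons_of_mem hr)
      have ha := hs a (Multiset.mem_cons_self a s)
      rw [Multiset.card_cons] at hk
      rw [Multiset.map_cons, Multiset.prod_cons, sub_mul, coeff_sub, coeff_C_mul]
      have hdeg : (s.map fun a => X - C a).prod.natDegree = s.card := by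
        simp
      have h0 : ∀ k, 0 ≤ (s.map fun a => X - C a).prod.coeff k := fun k => by
        by_cases hk : k ≤ s.card
        · exact (ih k hk).le
        · rw [coeff_eq_zero_of_natDegree_lt (by omega)]
      cases k with
      | zero =>
        rw [mul_coeff_zero, coeff_X_zero]
        nlinarith [ih 0 (Nat.zero_le _)]
      | succ k =>
        rw [coeff_X_mul]
        nlinarith [ih k (by omega), h0 (k + 1)]
  have hp0 : p ≠ 0 := by rintro rfl; simp at hlc
  rw [hp.eq_prod_roots, coeff_C_mul]
  refine mul_pos hlc (key _ (fun r hr => ?_) k (by rwa [← hp.natDegree_eq_card_roots]))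
  by_contra! hr0
  exact h r hr0 ((mem_roots hp0).1 hr)

open Polynomial in
/-- In a continuous family of real-rooted polynomials of constant degree without a root at `0`,
strict positivity of the coefficients propagates. -/
theorem Polynomial.coeff_pos_of_family (P : ℝ[X][X]) (d : ℕ)
    (hdeg : ∀ b : ℝ, 0 ≤ b → (P.map (evalRingHom b)).natDegree ≤ d)
    (hlead : ∀ b : ℝ, 0 ≤ b → 0 < (P.map (evalRingHom b)).coeff d)
    (hsplit : ∀ b : ℝ, 0 ≤ b → (P.map (evalRingHom b)).Splits)
    (hzero : ∀ b : ℝ, 0 ≤ b → 0 < (P.map (evalRingHom b)).coeff 0)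
    (hpos : ∀ k ≤ d, 0 < (P.map (evalRingHom 0)).coeff k) :
    ∀ k ≤ d, 0 < (P.map (evalRingHom 1)).coeff k := by
  have hnat : ∀ b : ℝ, 0 ≤ b → (P.map (evalRingHom b)).natDegree = d := fun b hb =>
    le_antisymm (hdeg b hb) (le_natDegree_of_ne_zero (hlead b hb).ne')
  have hcont : ∀ k, Continuous fun b : ℝ => (P.map (evalRingHom b)).coeff k := fun k => by
    simp only [coeff_map, coe_evalRingHom]
    exact (P.coeff k).continuous
  have hup : ∀ b : ℝ, 0 ≤ b → (∀ k ≤ d, 0 ≤ (P.map (evalRingHom b)).coeff k) →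
      ∀ k ≤ d, 0 < (P.map (evalRingHom b)).coeff k := by
    intro b hb h k hk
    refine (hsplit b hb).coeff_pos ?_ (fun x hx => ?_) (by rwa [hnat b hb])
    · rw [leadingCoeff, hnat b hb]; exact hlead b hb
    · rw [eval_eq_sum_range, hnat b hb]
      refine (Finset.sum_pos' (fun k hk => ?_) ⟨0, by simp, by simpa using hzero b hb⟩).ne'
      exact mul_nonneg (h k (by simpa [Nat.lt_succ_iff] using hk)) (pow_nonneg hx k)
  have hO : IsOpen {b : ℝ | ∀ k ∈ Finset.range (d + 1), 0 < (P.map (evalRingHom b)).coeff k} := by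
    simp only [Set.ofPred_forall]
    exact isOpen_biInter_finset fun k _ => isOpen_lt continuous_const (hcont k)
  have hC : IsClosed {b : ℝ | ∀ k ∈ Finset.range (d + 1), 0 ≤ (P.map (evalRingHom b)).coeff k} := by
    simp only [Set.ofPred_forall]
    exact isClosed_biInter fun k _ => isClosed_le continuous_const (hcont k)
  have hsub : Set.Icc (0 : ℝ) 1 ⊆
      {b : ℝ | ∀ k ∈ Finset.range (d + 1), 0 < (P.map (evalRingHom b)).coeff k} := by
    refine isPreconnected_Icc.subset_of_closure_inter_subset hO
      ⟨0, by simp, fun k hk => hpos k (by simpa [Nat.lt_succ_iff] using hk)⟩ ?_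
    rintro b ⟨hb, hb'⟩
    have hbC := closure_minimal (fun b hb k hk => (hb k hk).le) hC hb
    exact fun k hk => hup b hb'.1 (fun k hk => hbC k (by simpa [Nat.lt_succ_iff] using hk)) k
      (by simpa [Nat.lt_succ_iff] using hk)
  exact fun k hk => hsub ⟨zero_le_one, le_rfl⟩ k (by simpa [Nat.lt_succ_iff] using hk)

/-- The polynomial `det (x I + Σ z_i A_i)`. -/
noncomputable abbrev detPencil {m d : ℕ} (A : Fin m → Matrix (Fin d) (Fin d) ℂ) :
    MvPolynomial (Option (Fin m)) ℂ :=
  Matrix.det (Matrix.of fun a b =>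
    MvPolynomial.X (none : Option (Fin m)) * (if a = b then 1 else 0) +
      ∑ i, MvPolynomial.X (some i) * MvPolynomial.C (A i a b))

theorem algHom_detPencil {m d : ℕ} (A : Fin m → Matrix (Fin d) (Fin d) ℂ) {S : Type*}
    [CommRing S] [Algebra ℂ S] (φ : MvPolynomial (Option (Fin m)) ℂ →ₐ[ℂ] S) :
    φ (detPencil A) = Matrix.det (Matrix.of fun a b =>
      φ (MvPolynomial.X none) * (if a = b then 1 else 0) +
        ∑ i, φ (MvPolynomial.X (some i)) * algebraMap ℂ S (A i a b)) := by
  rw [detPencil, AlgHom.map_det]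
  congr 1
  ext a b
  simp [apply_ite φ, ← MvPolynomial.algebraMap_eq]

theorem upperNonvanishing_detPencil {m d : ℕ} {A : Fin m → Matrix (Fin d) (Fin d) ℂ}
    (hA : ∀ i, (A i).PosSemidef) : UpperNonvanishing (detPencil A) := by
  intro v h0 h hdet
  rw [← MvPolynomial.coe_aeval_eq_eval, RingHom.coe_coe, algHom_detPencil] at hdet
  obtain ⟨w, hw, hMw⟩ := Matrix.exists_mulVec_eq_zero_iff.2 hdet
  have hM : (Matrix.of fun a b : Fin d => MvPolynomial.aeval v (MvPolynomial.X (R := ℂ) none) *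
      (if a = b then (1 : ℂ) else 0) + ∑ i, MvPolynomial.aeval v (MvPolynomial.X (R := ℂ) (some i)) *
        algebraMap ℂ ℂ (A i a b)) = v none • (1 : Matrix (Fin d) (Fin d) ℂ) +
      ∑ i, v (some i) • A i := by
    ext a b
    simp [Matrix.sum_apply, Matrix.one_apply]
  rw [hM, Matrix.add_mulVec, Matrix.sum_mulVec] at hMw
  have h1 := congrArg (fun u => (star w ⬝ᵥ u).im) hMw
  simp only [dotProduct_add, dotProduct_sum, Matrix.smul_mulVec, dotProduct_smul,
    Matrix.one_mulVec, dotProduct_zero, Complex.add_im, Complex.im_sum, smul_eq_mul,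
    Complex.zero_im] at h1
  have hp : ∀ z q : ℂ, 0 ≤ q → (z * q).im = z.im * q.re := fun z q hq => by
    rw [Complex.mul_im, ← (Complex.le_def.1 hq).2]; simp
  have hww : 0 < star w ⬝ᵥ w := Matrix.dotProduct_star_self_pos_iff.2 hw
  rw [hp _ _ hww.le, Finset.sum_congr rfl fun i _ =>
    hp _ _ ((hA i).dotProduct_mulVec_nonneg w)] at h1
  have h2 := mul_pos h0 (Complex.lt_def.1 hww).1
  have h3 : 0 ≤ ∑ i, (v (some i)).im * (star w ⬝ᵥ (A i).mulVec w).re :=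
    Finset.sum_nonneg fun i _ =>
      mul_nonneg (h i) (Complex.le_def.1 ((hA i).dotProduct_mulVec_nonneg w)).1
  exact (add_pos_of_pos_of_nonneg h2 h3).ne' h1

theorem map_conj_detPencil {m d : ℕ} {A : Fin m → Matrix (Fin d) (Fin d) ℂ}
    (hA : ∀ i, (A i).IsHermitian) :
    MvPolynomial.map (starRingEnd ℂ) (detPencil A) = detPencil A := by
  conv_rhs => rw [detPencil, ← Matrix.det_transpose]
  rw [detPencil, RingHom.map_det]
  congr 1
  ext1 a b
  have : ∀ i, (starRingEnd ℂ) (A i a b) = A i b a := fun i => (hA i).apply b a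
  simp [apply_ite (MvPolynomial.map (starRingEnd ℂ)), this, eq_comm]

theorem coeff_detPencil_eq_zero {m d : ℕ} (A : Fin m → Matrix (Fin d) (Fin d) ℂ)
    {n : Option (Fin m) →₀ ℕ} (hn : d < n.degree) : (detPencil A).coeff n = 0 := by
  have h : (detPencil A).IsHomogeneous (∑ _a : Fin d, 1) := by
    rw [detPencil, Matrix.det_apply]
    refine MvPolynomial.IsHomogeneous.sum _ _ _ fun σ _ => ?_
    refine (MvPolynomial.homogeneousSubmodule _ _ _).smul_of_tower_mem _ ?_
    refine MvPolynomial.IsHomogeneous.prod _ _ _ fun a _ => ?_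
    rw [Matrix.of_apply]
    refine MvPolynomial.IsHomogeneous.add ?_ (MvPolynomial.IsHomogeneous.sum _ _ _ fun i _ =>
      (MvPolynomial.isHomogeneous_X ℂ (some i)).mul (MvPolynomial.isHomogeneous_C _ _))
    split_ifs
    · simpa using MvPolynomial.isHomogeneous_X ℂ none
    · simpa using MvPolynomial.isHomogeneous_zero _ _ _
  exact h.coeff_eq_zero (by simpa using hn.ne')

theorem MvPolynomial.coeff_sub_smul_pderiv_of_le_degree {σ R : Type*} [CommRing R] {d : ℕ}
    {p D : MvPolynomial σ R} (hD : ∀ n, d < n.degree → D.coeff n = 0)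
    (hp : ∀ n, d ≤ n.degree → p.coeff n = D.coeff n) (c : R) (i : σ) :
    ∀ n, d ≤ n.degree → (p - c • pderiv i p).coeff n = D.coeff n := by
  intro n hn
  have h1 : d < (n + Finsupp.single i 1).degree := by
    simp [map_add]; omega
  rw [coeff_sub, coeff_smul, coeff_pderiv, hp n hn, hp _ h1.le, hD _ h1]
  simp

theorem MvPolynomial.exists_map_ofReal_of_map_conj {σ : Type*} {p : MvPolynomial σ ℂ}
    (hp : MvPolynomial.map (starRingEnd ℂ) p = p) :
    ∃ q : MvPolynomial σ ℝ, MvPolynomial.map Complex.ofRealHom q = p := by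
  refine MvPolynomial.mem_range_map_iff_coeffs_subset.2 fun c hc => ?_
  obtain ⟨n, -, rfl⟩ := MvPolynomial.mem_coeffs_iff.1 hc
  refine ⟨(p.coeff n).re, Complex.conj_eq_iff_re.1 ?_⟩
  rw [← MvPolynomial.coeff_map, hp]

/-- The differential operator `∏ (1 - c_i ∂_{z_i})`, the product being over `l`. -/
noncomputable abbrev prodSubPderiv {ι : Type*} (c : ι → ℂ) (l : List ι) :
    Module.End ℂ (MvPolynomial (Option ι) ℂ) :=
  (l.map fun i => ((1 : Module.End ℂ (MvPolynomial (Option ι) ℂ)) -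
    c i • (MvPolynomial.pderiv (some i)).toLinearMap :
    Module.End ℂ (MvPolynomial (Option ι) ℂ))).prod

theorem prodSubPderiv_induction {ι : Type*} (c : ι → ℂ) {P : MvPolynomial (Option ι) ℂ → Prop}
    (hP : ∀ i p, P p → P (p - c i • MvPolynomial.pderiv (some i) p)) (l : List ι)
    {p : MvPolynomial (Option ι) ℂ} (hp : P p) : P (prodSubPderiv c l p) := by
  induction l with
  | nil => simpa [prodSubPderiv]
  | cons i l ih =>
    rw [prodSubPderiv, List.map_cons, List.prod_cons, Module.End.mul_apply]
    exact hP i _ ih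

/-- The substitution `x ↦ x`, `z_i ↦ c_i z_i`. -/
noncomputable def scaleSubst {m : ℕ} (c : Fin m → ℂ) :
    MvPolynomial (Option (Fin m)) ℂ →ₐ[ℂ] MvPolynomial (Fin m) (Polynomial ℂ) :=
  MvPolynomial.aeval fun o => o.elim (MvPolynomial.C Polynomial.X)
    fun i => MvPolynomial.C (Polynomial.C (c i)) * MvPolynomial.X i

theorem scaleSubst_detPencil {m d : ℕ} (A : Fin m → Matrix (Fin d) (Fin d) ℂ) (c : Fin m → ℂ) :
    scaleSubst c (detPencil A) = Matrix.det (Matrix.of fun a b =>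
        MvPolynomial.C Polynomial.X * (if a = b then 1 else 0) +
          ∑ i, MvPolynomial.X i * MvPolynomial.C (Polynomial.C ((c i • A i) a b))) := by
  refine (algHom_detPencil A (scaleSubst c)).trans
    (congrArg Matrix.det (Matrix.ext fun a b => ?_))
  have hn : scaleSubst c (MvPolynomial.X none) = MvPolynomial.C Polynomial.X := by
    simp [scaleSubst]
  have hs : ∀ i, scaleSubst c (MvPolynomial.X (some i)) =
      MvPolynomial.C (Polynomial.C (c i)) * MvPolynomial.X i := by
    simp [scaleSubst]
  rw [Matrix.of_apply, Matrix.of_apply, hn]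
  rw [add_right_inj]
  refine Finset.sum_congr rfl fun i _ => ?_
  rw [hs, Matrix.smul_apply, smul_eq_mul, map_mul, map_mul, MvPolynomial.algebraMap_apply,
    Polynomial.algebraMap_apply, Algebra.algebraMap_self_apply]
  ring

theorem pderiv_scaleSubst {m : ℕ} (c : Fin m → ℂ) (i : Fin m)
    (p : MvPolynomial (Option (Fin m)) ℂ) :
    MvPolynomial.pderiv i (scaleSubst c p) =
      scaleSubst c (c i • MvPolynomial.pderiv (some i) p) := by
  induction p using MvPolynomial.induction_on with
  | C a => simp [scaleSubst, MvPolynomial.algebraMap_apply]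
  | add p q hp hq => simp [hp, hq]
  | mul_X p j hp =>
    rw [map_mul, MvPolynomial.pderiv_mul, hp, MvPolynomial.pderiv_mul]
    cases j with
    | none =>
      simp [scaleSubst]
    | some j =>
      by_cases hj : j = i
      · subst hj
        simp [scaleSubst, Algebra.smul_def, MvPolynomial.algebraMap_apply]
        ring
      · simp [scaleSubst, hj]

theorem eval_scaleSubst {m : ℕ} (c : Fin m → ℂ) (x : ℂ) (p : MvPolynomial (Option (Fin m)) ℂ) :
    (MvPolynomial.eval (fun _ => (0 : Polynomial ℂ)) (scaleSubst c p)).eval x =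
      MvPolynomial.eval (fun o => o.elim x fun _ => 0) p := by
  induction p using MvPolynomial.induction_on with
  | C a => simp [scaleSubst, MvPolynomial.algebraMap_apply]
  | add p q hp hq => rw [map_add, map_add, Polynomial.eval_add, hp, hq, map_add]
  | mul_X p j hp =>
    rw [map_mul, map_mul, Polynomial.eval_mul, hp, map_mul]
    cases j <;> simp [scaleSubst]

theorem eval_mixedCharPoly {m d : ℕ} (A : Fin m → Matrix (Fin d) (Fin d) ℂ) (c : Fin m → ℂ)
    (x : ℂ) :
    (mixedCharPoly fun i => c i • A i).eval x =
      MvPolynomial.eval (fun o => o.elim x fun _ => 0)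
        (prodSubPderiv c (List.finRange m) (detPencil A)) := by
  have key : ∀ l : List (Fin m), scaleSubst c (prodSubPderiv c l (detPencil A)) =
      (l.map fun i =>
        ((1 : Module.End (Polynomial ℂ) (MvPolynomial (Fin m) (Polynomial ℂ))) -
          (MvPolynomial.pderiv i).toLinearMap :
          Module.End (Polynomial ℂ) (MvPolynomial (Fin m) (Polynomial ℂ)))).prod
        (scaleSubst c (detPencil A)) := by
    intro l
    induction l with
    | nil => simp [prodSubPderiv]
    | cons i l ih =>
      rw [prodSubPderiv, List.map_cons, List.map_cons, List.prod_cons, List.prod_cons,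
        Module.End.mul_apply, Module.End.mul_apply, ← ih]
      simp [pderiv_scaleSubst]
  rw [mixedCharPoly, List.ofFn_eq_map, ← scaleSubst_detPencil, ← key]
  exact eval_scaleSubst c x _

/-- The substitution `x ↦ x₁ + a s`, `z_i ↦ t_i s` along a line. -/
noncomputable def lineSubst {ι : Type*} (x₁ a : ℂ) (t : ι → ℂ) :
    MvPolynomial (Option ι) ℂ →ₐ[ℂ] Polynomial ℂ :=
  MvPolynomial.aeval fun o => o.elim (Polynomial.C x₁ + Polynomial.C a * Polynomial.X)
    fun i => Polynomial.C (t i) * Polynomial.X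

theorem eval_lineSubst {ι : Type*} (x₁ a : ℂ) (t : ι → ℂ) (p : MvPolynomial (Option ι) ℂ) (s : ℂ) :
    (lineSubst x₁ a t p).eval s =
      MvPolynomial.eval (fun o => o.elim (x₁ + a * s) fun i => t i * s) p := by
  induction p using MvPolynomial.induction_on with
  | C a => simp [lineSubst]
  | add p q hp hq => rw [map_add, Polynomial.eval_add, hp, hq, map_add]
  | mul_X p j hp =>
    rw [map_mul, Polynomial.eval_mul, hp, map_mul]
    cases j <;> simp [lineSubst]

theorem coeff_lineSubst_eq_zero {ι : Type*} (x₁ a : ℂ) (t : ι → ℂ)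
    {p : MvPolynomial (Option ι) ℂ} {d k : ℕ} (hp : ∀ n, d ≤ n.degree → p.coeff n = 0)
    (hk : d ≤ k) : (lineSubst x₁ a t p).coeff k = 0 := by
  cases d with
  | zero =>
    have : p = 0 := MvPolynomial.ext _ _ fun n => by simpa using hp n (Nat.zero_le _)
    simp [this]
  | succ e =>
    have hdeg : p.totalDegree ≤ e := by
      refine Finset.sup_le fun n hn => ?_
      by_contra! hlt
      exact MvPolynomial.mem_support_iff.1 hn (hp n hlt)
    refine Polynomial.coeff_eq_zero_of_natDegree_lt
      ((MvPolynomial.aeval_natDegree_le p hdeg _ (n := 1) fun o => ?_).trans_lt (by omega))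
    cases o
    · simp only [Option.elim]
      compute_degree
    · simp only [Option.elim]
      compute_degree

theorem lineSubst_detPencil {m d : ℕ} (A : Fin m → Matrix (Fin d) (Fin d) ℂ) (x₁ a : ℂ)
    (t : Fin m → ℂ) :
    lineSubst x₁ a t (detPencil A) = Matrix.det ((Polynomial.X : Polynomial ℂ) •
      (a • (1 : Matrix (Fin d) (Fin d) ℂ) + ∑ i, t i • A i).map Polynomial.C +
        (x₁ • (1 : Matrix (Fin d) (Fin d) ℂ)).map Polynomial.C) := by
  rw [algHom_detPencil]
  refine congrArg Matrix.det (Matrix.ext fun b c => ?_)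
  simp only [lineSubst, Matrix.of_apply, MvPolynomial.aeval_X, Option.elim, Matrix.add_apply,
    Matrix.smul_apply, Matrix.map_apply, Matrix.sum_apply, Matrix.one_apply, smul_eq_mul,
    map_add, map_sum, map_mul, mul_add, Finset.mul_sum, Polynomial.algebraMap_eq]
  rw [add_mul, add_comm (_ * _) (_ * _), add_right_comm]
  congr 1
  · congr 1
    · split_ifs <;> simp [Polynomial.X_mul_C]
    · exact Finset.sum_congr rfl fun i _ => by ring
  · split_ifs <;> simp

theorem lineSubst_natDegree_le_and_coeff {m d : ℕ} (A : Fin m → Matrix (Fin d) (Fin d) ℂ)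
    (x₁ a : ℂ) (t : Fin m → ℂ) {p : MvPolynomial (Option (Fin m)) ℂ}
    (hp : ∀ n, d ≤ n.degree → p.coeff n = (detPencil A).coeff n) :
    (lineSubst x₁ a t p).natDegree ≤ d ∧
      (lineSubst x₁ a t p).coeff d =
        (a • (1 : Matrix (Fin d) (Fin d) ℂ) + ∑ i, t i • A i).det := by
  have h0 : ∀ k, d ≤ k → (lineSubst x₁ a t p).coeff k =
      (lineSubst x₁ a t (detPencil A)).coeff k := fun k hk => by
    rw [← sub_eq_zero, ← Polynomial.coeff_sub, ← map_sub]
    exact coeff_lineSubst_eq_zero x₁ a t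
      (fun n hn => by rw [MvPolynomial.coeff_sub, hp n hn, sub_self]) hk
  constructor
  · refine Polynomial.natDegree_le_iff_coeff_eq_zero.2 fun k hk => ?_
    rw [h0 k hk.le, lineSubst_detPencil]
    exact Polynomial.coeff_eq_zero_of_natDegree_lt
      ((Polynomial.natDegree_det_X_add_C_le _ _).trans_lt (by simpa using hk))
  · rw [h0 d le_rfl, lineSubst_detPencil]
    simpa using Polynomial.coeff_det_X_add_C_card
      (a • (1 : Matrix (Fin d) (Fin d) ℂ) + ∑ i, t i • A i) (x₁ • 1)

/-- The real family `b ↦ q(x₁ + a s, b t s)` of polynomials in `s`. -/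
noncomputable def lineFamily {ι : Type*} (x₁ a : ℝ) (t : ι → ℝ) :
    MvPolynomial (Option ι) ℝ →ₐ[ℝ] Polynomial (Polynomial ℝ) :=
  MvPolynomial.aeval fun o => o.elim
    (Polynomial.C (Polynomial.C x₁) + Polynomial.C (Polynomial.C a) * Polynomial.X)
    fun i => Polynomial.C (Polynomial.C (t i) * Polynomial.X) * Polynomial.X

theorem map_lineFamily {ι : Type*} (x₁ a : ℝ) (t : ι → ℝ) (q : MvPolynomial (Option ι) ℝ) (b : ℝ) :
    ((lineFamily x₁ a t q).map (Polynomial.evalRingHom b)).map Complex.ofRealHom =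
      lineSubst (x₁ : ℂ) a (fun i => ((t i * b : ℝ) : ℂ)) (MvPolynomial.map Complex.ofRealHom q) := by
  induction q using MvPolynomial.induction_on with
  | C a => simp [lineSubst, lineFamily, Polynomial.algebraMap_apply]
  | add p q hp hq => rw [map_add, Polynomial.map_add, Polynomial.map_add, hp, hq, map_add, map_add]
  | mul_X p j hp =>
    rw [map_mul, Polynomial.map_mul, Polynomial.map_mul, hp, map_mul, map_mul]
    cases j <;> simp [lineSubst, lineFamily]

theorem UpperNonvanishing.eval_pos {m d : ℕ} {A : Fin m → Matrix (Fin d) (Fin d) ℂ}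
    (hA : ∀ i, (A i).PosSemidef) {Q : MvPolynomial (Option (Fin m)) ℂ} (hQ : UpperNonvanishing Q)
    (hconj : MvPolynomial.map (starRingEnd ℂ) Q = Q)
    (hcoeff : ∀ n, d ≤ n.degree → Q.coeff n = (detPencil A).coeff n) {x₁ y : ℝ} (hxy : x₁ < y)
    (hx₁ : ∀ x : ℝ, x₁ ≤ x → MvPolynomial.eval (fun o => o.elim (x : ℂ) fun _ => 0) Q ≠ 0)
    {t : Fin m → ℝ} (ht : ∀ i, 0 ≤ t i) :
    ∃ r : ℝ, 0 < r ∧ MvPolynomial.eval (fun o => o.elim (y : ℂ) fun i => (t i : ℂ)) Q = r := by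
  obtain ⟨q, rfl⟩ := MvPolynomial.exists_map_ofReal_of_map_conj hconj
  set Q := MvPolynomial.map Complex.ofRealHom q
  have ha : 0 < y - x₁ := sub_pos.2 hxy
  set P := lineFamily x₁ (y - x₁) t q
  have hmap := map_lineFamily x₁ (y - x₁) t q
  have heval : ∀ b s : ℝ, (((P.map (Polynomial.evalRingHom b)).eval s : ℝ) : ℂ) =
      MvPolynomial.eval (fun o => o.elim ((x₁ : ℂ) + ((y - x₁ : ℝ) : ℂ) * s)
        fun i => ((t i * b : ℝ) : ℂ) * s) Q := fun b s => by
    rw [← eval_lineSubst, ← hmap]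
    exact (Polynomial.eval_map_apply (f := Complex.ofRealHom) (p := P.map _) s).symm
  have hdeg : ∀ b : ℝ, 0 ≤ b → (P.map (Polynomial.evalRingHom b)).natDegree ≤ d := fun b _ => by
    rw [← Polynomial.natDegree_map Complex.ofRealHom, hmap]
    exact (lineSubst_natDegree_le_and_coeff A _ _ _ hcoeff).1
  have hlead : ∀ b : ℝ, 0 ≤ b → 0 < (P.map (Polynomial.evalRingHom b)).coeff d := fun b hb => by
    have hpd : (((y - x₁ : ℝ) : ℂ) • (1 : Matrix (Fin d) (Fin d) ℂ) +
        ∑ i, ((t i * b : ℝ) : ℂ) • A i).PosDef := by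
      refine (Matrix.PosDef.one.smul (by exact_mod_cast ha)).add_posSemidef
        (Matrix.posSemidef_sum _ fun i _ => (hA i).smul ?_)
      exact_mod_cast mul_nonneg (ht i) hb
    have := hpd.det_pos
    rw [← (lineSubst_natDegree_le_and_coeff A (x₁ : ℂ) _ _ hcoeff).2, ← hmap,
      Polynomial.coeff_map] at this
    exact Complex.zero_lt_real.1 this
  have hsplit : ∀ b : ℝ, 0 ≤ b → (P.map (Polynomial.evalRingHom b)).Splits := fun b hb => by
    refine Polynomial.splits_of_eval_ne_zero_of_im_pos fun z hz => ?_
    rw [hmap, eval_lineSubst]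
    refine hQ _ ?_ fun i => ?_
    · simpa only [Option.elim, Complex.add_im, Complex.ofReal_im, Complex.im_ofReal_mul, zero_add]
        using mul_pos ha hz
    · simpa only [Option.elim, Complex.im_ofReal_mul]
        using mul_nonneg (mul_nonneg (ht i) hb) hz.le
  have hpos : ∀ k ≤ d, 0 < (P.map (Polynomial.evalRingHom 0)).coeff k := fun k hk => by
    have hnat : (P.map (Polynomial.evalRingHom 0)).natDegree = d := le_antisymm (hdeg 0 le_rfl)
      (Polynomial.le_natDegree_of_ne_zero (hlead 0 le_rfl).ne')
    refine (hsplit 0 le_rfl).coeff_pos ?_ (fun s hs h0 => ?_) (by rwa [hnat])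
    · rw [Polynomial.leadingCoeff, hnat]
      exact hlead 0 le_rfl
    · have := heval 0 s
      rw [h0] at this
      refine hx₁ (x₁ + (y - x₁) * s) (by nlinarith) ?_
      simpa using this.symm
  have hzero : ∀ b : ℝ, 0 ≤ b → 0 < (P.map (Polynomial.evalRingHom b)).coeff 0 := fun b _ => by
    have : (P.map (Polynomial.evalRingHom b)).coeff 0 =
        (P.map (Polynomial.evalRingHom 0)).coeff 0 := by
      rw [Polynomial.coeff_zero_eq_eval_zero, Polynomial.coeff_zero_eq_eval_zero,
        ← Complex.ofReal_inj, heval, heval]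
      simp
    rw [this]
    exact hpos 0 (Nat.zero_le d)
  have hone := Polynomial.coeff_pos_of_family P d hdeg hlead hsplit hzero hpos
  refine ⟨(P.map (Polynomial.evalRingHom 1)).eval 1, ?_, ?_⟩
  · rw [Polynomial.eval_eq_sum_range' (Nat.lt_succ_of_le (hdeg 1 zero_le_one))]
    refine Finset.sum_pos (fun k hk => ?_) ⟨0, by simp⟩
    simpa using hone k (Nat.lt_succ_iff.1 (Finset.mem_range.1 hk))
  · rw [heval]
    simp

/-- `(x₀,0,…,0)` is above the roots of
`Q_m = ∏ (1 − ε_i ∂_{z_i}) det(x I + Σ z_i A_i)` (Lemma `abp`).  The variable `x`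
is indexed by `none` and `z_i` by `some i`. -/
theorem statement11 {m d : ℕ} (A : Fin m → Matrix (Fin d) (Fin d) ℂ)
    (hA : ∀ i, (A i).PosSemidef) (ε : Fin m → ℝ) (hε : ∀ i, ε i = 1 ∨ ε i = -1)
    (x₀ : ℝ) (hx₀ : 0 < x₀)
    (hroot : maxRoot (mixedCharPoly fun i => (ε i : ℂ) • A i) < x₀) :
    AboveRootsC
      ((List.ofFn fun i : Fin m =>
          ((1 : Module.End ℂ (MvPolynomial (Option (Fin m)) ℂ)) -
            (ε i : ℂ) • (MvPolynomial.pderiv (some i)).toLinearMap :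
            Module.End ℂ (MvPolynomial (Option (Fin m)) ℂ))).prod
        (Matrix.det (Matrix.of fun a b =>
          MvPolynomial.X (none : Option (Fin m)) * (if a = b then 1 else 0) +
            ∑ i, MvPolynomial.X (some i) * MvPolynomial.C (A i a b))))
      (fun o => o.elim x₀ fun _ => 0) := by
  have hQU : UpperNonvanishing (prodSubPderiv (fun i => (ε i : ℂ)) (List.finRange m)
      (detPencil A)) :=
    prodSubPderiv_induction _ (fun i _ hp => hp.sub_smul_pderiv (ε i) i) _
      (upperNonvanishing_detPencil hA)
  have hconj : MvPolynomial.map (starRingEnd ℂ) (prodSubPderiv (fun i => (ε i : ℂ))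
      (List.finRange m) (detPencil A)) = prodSubPderiv (fun i => (ε i : ℂ)) (List.finRange m)
      (detPencil A) :=
    prodSubPderiv_induction (P := fun p => MvPolynomial.map (starRingEnd ℂ) p = p) _
      (fun i p hp => by simp [MvPolynomial.smul_eq_C_mul, hp, ← MvPolynomial.pderiv_map]) _
      (map_conj_detPencil fun i => (hA i).isHermitian)
  have hcoeff : ∀ n : Option (Fin m) →₀ ℕ, d ≤ n.degree →
      (prodSubPderiv (fun i => (ε i : ℂ)) (List.finRange m) (detPencil A)).coeff n =
        (detPencil A).coeff n :=
    prodSubPderiv_induction (P := fun p => ∀ n : Option (Fin m) →₀ ℕ, d ≤ n.degree →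
        p.coeff n = (detPencil A).coeff n) _
      (fun i p hp => MvPolynomial.coeff_sub_smul_pderiv_of_le_degree
        (fun n hn => coeff_detPencil_eq_zero A hn) hp (ε i : ℂ) (some i)) _ (fun _ _ => rfl)
  have hmix := eval_mixedCharPoly A fun i => (ε i : ℂ)
  rw [List.ofFn_eq_map]
  change AboveRootsC (prodSubPderiv (fun i => (ε i : ℂ)) (List.finRange m) (detPencil A)) _
  generalize prodSubPderiv (fun i => (ε i : ℂ)) (List.finRange m) (detPencil A) = Q
    at hQU hconj hcoeff hmix ⊢
  set μ := mixedCharPoly fun i => (ε i : ℂ) • A i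
  have hμ : μ ≠ 0 := fun h => by
    have := hmix Complex.I
    rw [h, Polynomial.eval_zero] at this
    exact hQU _ (by simp) (by simp) this.symm
  have hbdd : BddAbove {x : ℝ | μ.IsRoot (x : ℂ)} :=
    (Set.Finite.preimage (Complex.ofReal_injective.injOn)
      (Polynomial.finite_setOfPred_isRoot hμ)).bddAbove
  obtain ⟨x₁, h₁, h₂⟩ := exists_between hroot
  intro t ht
  obtain ⟨r, hr, hQr⟩ := hQU.eval_pos hA hconj hcoeff
    (h₂.trans_le (le_add_of_nonneg_right (ht none)))
    (fun x hx h => (h₁.trans_le hx).not_ge (le_csSup hbdd ((hmix x).trans h)))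
    (fun i => ht (some i))
  have hpt : (fun o : Option (Fin m) => (((o.elim x₀ fun _ => 0) + t o : ℝ) : ℂ)) =
      fun o => o.elim ((x₀ + t none : ℝ) : ℂ) fun i => (t (some i) : ℂ) := by
    funext o
    cases o <;> simp
  rw [hpt, hQr]
  exact ⟨Complex.ofReal_im r, by simpa using hr⟩
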